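/- For every pair of integers d ≥ 1 and 0 ≤ m ≤ d−1 there exists a constant f(d,m) > 0 with the following property. For every integer n ≥ 1 and every coloring χ : ({0,…,n})^d → Colors such that every cubical (m+1)-dimensional face of the grid carries at most m+1 distinct colors on its vertices, there exists a set M of lattice points of {0,…,n}^d which is monochromatic (χ is constant on M), connected in the adjacency graph, and satisfies |M| ≥ f(d,m) · n^{d−m}. -/

import Mathlib

namespace CubeCol
open Finset

/-- shift by one in direction `i` -/
def sh {d : ℕ} (x : Fin d → ℕ) (i : Fin d) : Fin d → ℕ := Function.update x i (x i + 1)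

/-- shift by the indicator of `T` -/
def shT {d : ℕ} (x : Fin d → ℕ) (T : Finset (Fin d)) : Fin d → ℕ :=
  fun i => x i + if i ∈ T then 1 else 0

/-- cochains mod 2 of all degrees on the cubical lattice -/
abbrev Coch (d : ℕ) := Finset (Fin d) → (Fin d → ℕ) → ZMod 2

/-- coboundary -/
def cob {d : ℕ} (u : Coch d) : Coch d :=
  fun S x => ∑ i ∈ S, (u (S.erase i) x + u (S.erase i) (sh x i))

/-- the box -/
def box (d n : ℕ) : Finset (Fin d → ℕ) := Fintype.piFinset (fun _ => range (n + 1))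

/-- mass -/
def mass {d : ℕ} (n k : ℕ) (u : Coch d) : ℕ :=
  ∑ S ∈ powersetCard k univ, ∑ x ∈ box d n, (u S x).val

lemma mem_box {d n : ℕ} {x : Fin d → ℕ} : x ∈ box d n ↔ ∀ i, x i ≤ n := by
  simp [box, Fintype.mem_piFinset]

lemma card_box (d n : ℕ) : (box d n).card = (n + 1) ^ d := by
  simp [box]

lemma sh_comm {d : ℕ} (x : Fin d → ℕ) (i j : Fin d) : sh (sh x i) j = sh (sh x j) i := by
  funext t
  by_cases h1 : t = i <;> by_cases h2 : t = j <;> by_cases h3 : i = j <;>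
    simp_all [sh, Function.update_apply]

lemma update_sh {d : ℕ} (x : Fin d → ℕ) {i j : Fin d} (h : i ≠ j) (b : ℕ) :
    Function.update (sh x i) j b = sh (Function.update x j b) i := by
  unfold sh
  rw [Function.update_comm h, Function.update_of_ne h]

lemma update_sh_same {d : ℕ} (x : Fin d → ℕ) (j : Fin d) (b : ℕ) :
    Function.update (sh x j) j b = Function.update x j b := by
  simp [sh]

lemma sh_update_same {d : ℕ} (x : Fin d → ℕ) (j : Fin d) (b : ℕ) :
    sh (Function.update x j b) j = Function.update x j (b + 1) := by
  simp [sh]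

lemma sh_same {d : ℕ} (x : Fin d → ℕ) (j : Fin d) : sh x j j = x j + 1 := by simp [sh]
lemma sh_ne {d : ℕ} (x : Fin d → ℕ) {i j : Fin d} (h : j ≠ i) : sh x i j = x j := by simp [sh, h]

lemma z2_add_self (a : ZMod 2) : a + a = 0 := CharTwo.add_self_eq_zero a

lemma sum_symm_zero {α : Type*} [DecidableEq α] (A : Finset α) (F : α → α → ZMod 2)
    (hF : ∀ i j, F i j = F j i) : ∑ i ∈ A, ∑ j ∈ A.erase i, F i j = 0 := by
  rw [Finset.sum_sigma']
  refine Finset.sum_involution (fun p _ => ⟨p.2, p.1⟩) ?_ ?_ ?_ ?_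
  · rintro ⟨i, j⟩ _
    simp only
    rw [hF j i]; exact z2_add_self _
  · rintro ⟨i, j⟩ h _
    simp only [mem_sigma, mem_erase] at h
    intro h'
    simp only [Sigma.mk.injEq] at h'
    exact h.2.1 h'.1
  · rintro ⟨i, j⟩ h
    simp only [mem_sigma, mem_erase] at h ⊢
    exact ⟨h.2.2, h.2.1.symm, h.1⟩
  · rintro ⟨i, j⟩ _
    rfl

lemma sum_swap_erase {α M : Type*} [DecidableEq α] [AddCommMonoid M] (A : Finset α) (F : α → α → M) :
    ∑ i ∈ A, ∑ j ∈ A.erase i, F i j = ∑ j ∈ A, ∑ i ∈ A.erase j, F i j := by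
  refine Finset.sum_comm' ?_
  intro i j
  simp only [mem_erase]
  constructor
  · rintro ⟨h, h1, h2⟩; exact ⟨⟨h1.symm, h⟩, h2⟩
  · rintro ⟨⟨h, h1⟩, h2⟩; exact ⟨h1, h.symm, h2⟩

lemma val_sum_le {α : Type*} (A : Finset α) (f : α → ZMod 2) :
    (∑ i ∈ A, f i).val ≤ ∑ i ∈ A, (f i).val := by
  classical
  induction A using Finset.induction_on with
  | empty => simp
  | insert a s ha ih =>
    rw [sum_insert ha, sum_insert ha]
    exact (ZMod.val_add_le _ _).trans (by omega)

lemma mass_add_le {d : ℕ} (n k : ℕ) (u w : Coch d) :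
    mass n k (fun S x => u S x + w S x) ≤ mass n k u + mass n k w := by
  unfold mass
  rw [← sum_add_distrib]
  refine sum_le_sum fun S _ => ?_
  rw [← sum_add_distrib]
  exact sum_le_sum fun x _ => ZMod.val_add_le _ _

lemma mass_sum_le {d : ℕ} (n k : ℕ) {α : Type*} (A : Finset α) (u : α → Coch d) :
    mass n k (fun S x => ∑ c ∈ A, u c S x) ≤ ∑ c ∈ A, mass n k (u c) := by
  unfold mass
  rw [sum_comm (s := A)]
  refine sum_le_sum fun S _ => ?_
  rw [sum_comm (s := A)]
  exact sum_le_sum fun x _ => val_sum_le _ _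

lemma box_update (d n : ℕ) (j : Fin d) (h : (Fin d → ℕ) → ℕ) :
    ∑ x ∈ box d n, ∑ b ∈ range (n + 1), h (Function.update x j b) =
      (n + 1) * ∑ x ∈ box d n, h x := by
  have : (n + 1) * ∑ x ∈ box d n, h x = ∑ x ∈ box d n, ∑ b ∈ range (n + 1), h x := by
    simp [mul_sum]
  rw [this, ← sum_product', ← sum_product']
  have key : ∀ p ∈ box d n ×ˢ range (n + 1),
      (Function.update p.1 j p.2, p.1 j) ∈ box d n ×ˢ range (n + 1) := by
    rintro ⟨x, b⟩ hp
    simp only [mem_product, mem_box, mem_range] at hp ⊢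
    refine ⟨fun i => ?_, by have := hp.1 j; omega⟩
    by_cases hi : i = j
    · subst hi; simp; omega
    · simp [hi, hp.1 i]
  refine sum_bij' (fun p _ => (Function.update p.1 j p.2, p.1 j))
    (fun p _ => (Function.update p.1 j p.2, p.1 j)) key key ?_ ?_ ?_
  · rintro ⟨x, b⟩ _; simp
  · rintro ⟨x, b⟩ _; simp
  · rintro ⟨x, b⟩ _; simp

/-- cocycle condition in degree `k` -/
def IsCoc {d : ℕ} (k : ℕ) (u : Coch d) : Prop := ∀ S : Finset (Fin d), S.card = k + 1 →
  ∀ x, cob u S x = 0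

lemma fill_step {d n k : ℕ} (z : Coch d) (hz : IsCoc (k + 1) z) (j : Fin d) :
    ∃ (w z' : Coch d), (∀ S : Finset (Fin d), S.card = k + 1 → ∀ x, z S x = cob w S x + z' S x) ∧
      IsCoc (k + 1) z' ∧ (∀ S x, j ∈ S → z' S x = 0) ∧
      (∀ S, (∀ x, z S x = 0) → ∀ x, z' S x = 0) ∧
      mass n (k + 1) z' ≤ mass n (k + 1) z ∧
      mass n k w ≤ 2 * (n + 1) * mass n (k + 1) z := by
  classical
  obtain ⟨a, ha, hamin⟩ : ∃ a ∈ range (n + 1),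
      ∑ S ∈ powersetCard (k + 1) univ, ∑ x ∈ box d n, (z S (Function.update x j a)).val ≤
        mass n (k + 1) z := by
    refine exists_le_of_sum_le (by simp) (le_of_eq ?_)
    rw [sum_comm]
    simp only [sum_const, card_range, smul_eq_mul]
    unfold mass
    rw [mul_sum]
    refine sum_congr rfl fun S _ => ?_
    rw [← box_update d n j (fun x => (z S x).val), sum_comm]
  rw [mem_range] at ha
  let G : Finset (Fin d) → (Fin d → ℕ) → ℕ → ZMod 2 :=
    fun S x t => ∑ b ∈ range t, z (insert j S) (Function.update x j b)
  let w : Coch d := fun S x => if j ∈ S then 0 else G S x (x j) + G S x a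
  let z' : Coch d := fun S x => if j ∈ S then 0 else z S (Function.update x j a)
  refine ⟨w, z', ?_, ?_, ?_, ?_, ?_, ?_⟩
  · intro S hS x
    by_cases hj : j ∈ S
    · have h1 : cob w S x = z S x := by
        unfold cob
        rw [sum_eq_single_of_mem j hj]
        · simp only [w, mem_erase, ne_eq, not_true_eq_false, false_and, if_false, sh_same, G,
            update_sh_same, insert_erase hj]
          rw [sum_range_succ, Function.update_eq_self]
          have key : ∀ p q r : ZMod 2, p + q + (p + r + q) = r := by decide
          exact key _ _ _
        · intro i hi hij
          have : j ∈ S.erase i := mem_erase.2 ⟨hij.symm, hj⟩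
          simp [w, this]
      simp [h1, z', hj]
    · have hcoc : ∀ b, ∑ i ∈ S, (z (insert j (S.erase i)) (Function.update x j b) +
          z (insert j (S.erase i)) (Function.update (sh x i) j b)) =
          z S (Function.update x j b) + z S (Function.update x j (b + 1)) := by
        intro b
        have := hz (insert j S) (by rw [card_insert_of_notMem hj, hS]) (Function.update x j b)
        unfold cob at this
        rw [sum_insert hj, erase_insert hj, sh_update_same] at this
        have h2 : ∑ i ∈ S, (z ((insert j S).erase i) (Function.update x j b) +
            z ((insert j S).erase i) (sh (Function.update x j b) i)) =
            ∑ i ∈ S, (z (insert j (S.erase i)) (Function.update x j b) +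
          z (insert j (S.erase i)) (Function.update (sh x i) j b)) := by
          refine sum_congr rfl fun i hi => ?_
          have hij : i ≠ j := fun h => hj (h ▸ hi)
          rw [erase_insert_of_ne hij.symm, update_sh x hij]
        rw [h2] at this
        have key : ∀ p q r : ZMod 2, p + q + r = 0 → r = p + q := by decide
        exact key _ _ _ this
      have htel : ∀ t, ∑ b ∈ range t, (z S (Function.update x j b) +
          z S (Function.update x j (b + 1))) =
          z S (Function.update x j 0) + z S (Function.update x j t) := by
        intro t
        induction t with
        | zero => simp [z2_add_self]
        | succ t ih =>
          rw [sum_range_succ, ih]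
          linear_combination z2_add_self (z S (Function.update x j t))
      have hG : ∀ t, ∑ i ∈ S, (G (S.erase i) x t + G (S.erase i) (sh x i) t) =
          z S (Function.update x j 0) + z S (Function.update x j t) := by
        intro t
        rw [← htel, ← sum_congr rfl (fun b _ => hcoc b), sum_comm]
        refine sum_congr rfl fun i hi => ?_
        simp only [G]
        rw [← sum_add_distrib]
      have h1 : cob w S x = z S x + z S (Function.update x j a) := by
        have e : cob w S x = ∑ i ∈ S, (G (S.erase i) x (x j) + G (S.erase i) (sh x i) (x j)) +
            ∑ i ∈ S, (G (S.erase i) x a + G (S.erase i) (sh x i) a) := by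
          unfold cob
          rw [← sum_add_distrib]
          refine sum_congr rfl fun i hi => ?_
          have hij : j ≠ i := fun h => hj (h ▸ hi)
          have hj' : j ∉ S.erase i := fun h => hj (mem_of_mem_erase h)
          simp only [w, hj', if_false, sh_ne x hij]
          ring
        rw [e, hG, hG, Function.update_eq_self]
        linear_combination z2_add_self (z S (Function.update x j 0))
      rw [h1]
      simp only [z', hj, if_false]
      linear_combination -z2_add_self (z S (Function.update x j a))
  · intro S hS x
    by_cases hj : j ∈ S
    · unfold cob
      rw [sum_eq_single_of_mem j hj]
      · simp only [z', mem_erase, ne_eq, not_true_eq_false, false_and, if_false, update_sh_same]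
        exact z2_add_self _
      · intro i hi hij
        have : j ∈ S.erase i := mem_erase.2 ⟨hij.symm, hj⟩
        simp [z', this]
    · rw [← hz S hS (Function.update x j a)]
      unfold cob
      refine sum_congr rfl fun i hi => ?_
      have hij : i ≠ j := fun h => hj (h ▸ hi)
      have hj' : j ∉ S.erase i := fun h => hj (mem_of_mem_erase h)
      simp only [z', hj', if_false, update_sh x hij]
  · intro S x hj; simp [z', hj]
  · intro S h x; simp [z', h]
  · refine le_trans ?_ hamin
    unfold mass
    refine sum_le_sum fun S _ => sum_le_sum fun x _ => ?_
    by_cases hj : j ∈ S <;> simp [z', hj]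
  · have hGle : ∀ S x t, t ≤ n + 1 → (G S x t).val ≤
        ∑ b ∈ range (n + 1), (z (insert j S) (Function.update x j b)).val := by
      intro S x t ht
      refine (val_sum_le _ _).trans ?_
      exact sum_le_sum_of_subset (range_mono ht)
    have hw : ∀ S, j ∉ S → ∑ x ∈ box d n, (w S x).val ≤
        2 * ((n + 1) * ∑ x ∈ box d n, (z (insert j S) x).val) := by
      intro S hj
      rw [← box_update d n j, mul_sum]
      refine sum_le_sum fun x hx => ?_
      simp only [w, hj, if_false]
      have hxj := mem_box.1 hx j
      have h1 := hGle S x (x j) (by omega)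
      have h2 := hGle S x a (by omega)
      have h3 := ZMod.val_add_le (G S x (x j)) (G S x a)
      omega
    have hw0 : ∀ S, j ∈ S → ∑ x ∈ box d n, (w S x).val = 0 := by
      intro S hj; simp [w, hj]
    unfold mass
    rw [← sum_filter_add_sum_filter_not _ (fun S => j ∈ S),
      sum_eq_zero (fun S hS => hw0 S (mem_filter.1 hS).2), zero_add]
    refine (sum_le_sum fun S hS => hw S (mem_filter.1 hS).2).trans ?_
    rw [← mul_sum, ← mul_sum, mul_assoc]
    refine Nat.mul_le_mul_left _ (Nat.mul_le_mul_left _ ?_)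
    rw [← sum_image (s := filter (fun S => j ∉ S) (powersetCard k univ)) (g := fun S => insert j S)
      (f := fun S => ∑ x ∈ box d n, (z S x).val)]
    · refine sum_le_sum_of_subset ?_
      intro S hS
      simp only [mem_image, mem_filter, mem_powersetCard_univ] at hS ⊢
      obtain ⟨T, ⟨h1, h2⟩, rfl⟩ := hS
      rw [card_insert_of_notMem h2, h1]
    · intro S hS T hT h
      simp only [coe_filter, mem_powersetCard_univ, Set.mem_ofPred_eq] at hS hT
      simp only at h
      rw [← erase_insert hS.2, h, erase_insert hT.2]

lemma cob_add {d : ℕ} (u w : Coch d) (S : Finset (Fin d)) (x : Fin d → ℕ) :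
    cob (fun S x => u S x + w S x) S x = cob u S x + cob w S x := by
  unfold cob
  rw [← sum_add_distrib]
  exact sum_congr rfl fun i _ => by ring

lemma cob_sum {d : ℕ} {α : Type*} (A : Finset α) (u : α → Coch d) (S : Finset (Fin d))
    (x : Fin d → ℕ) :
    cob (fun S x => ∑ c ∈ A, u c S x) S x = ∑ c ∈ A, cob (u c) S x := by
  unfold cob
  rw [sum_comm]
  exact sum_congr rfl fun i _ => by rw [sum_add_distrib]

lemma fill {d n k : ℕ} (T : Finset (Fin d)) : ∀ z : Coch d, IsCoc (k + 1) z →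
    (∀ S, S.card = k + 1 → ¬ S ⊆ T → ∀ x, z S x = 0) →
    ∃ w : Coch d, (∀ S : Finset (Fin d), S.card = k + 1 → ∀ x, cob w S x = z S x) ∧
      mass n k w ≤ T.card * (2 * (n + 1) * mass n (k + 1) z) := by
  classical
  induction T using Finset.induction_on with
  | empty =>
    intro z _ h0
    refine ⟨fun _ _ => 0, ?_, by simp [mass]⟩
    intro S hS x
    rw [h0 S hS]
    · simp [cob]
    · intro h
      rw [subset_empty.1 h] at hS
      simp at hS
  | insert j T hj ih =>
    intro z hz h0
    obtain ⟨w1, z', h1, h2, h3, h4, h5, h6⟩ := fill_step (n := n) z hz j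
    obtain ⟨w2, g1, g2⟩ := ih z' h2 (by
      intro S hS hT x
      by_cases hjS : j ∈ S
      · exact h3 S x hjS
      · refine h4 S (h0 S hS ?_) x
        intro h
        exact hT ((subset_insert_iff_of_notMem hjS).1 h))
    refine ⟨fun S x => w1 S x + w2 S x, ?_, ?_⟩
    · intro S hS x
      rw [cob_add, g1 S hS, h1 S hS]
    · refine (mass_add_le _ _ _ _).trans ?_
      rw [card_insert_of_notMem hj, add_mul, one_mul, add_comm]
      refine add_le_add (g2.trans ?_) h6
      gcongr

end CubeCol

namespace CubeCol
open Finset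

/-- pullback of the simplicial cochains on colors: counts monotone paths with color set `τ` -/
def Z {d : ℕ} {C : Type} [DecidableEq C] (χ : (Fin d → ℕ) → C) :
    ℕ → Finset (Fin d) → (Fin d → ℕ) → Finset C → ZMod 2
  | 0, _, x, τ => if τ = {χ x} then 1 else 0
  | k + 1, S, x, τ =>
    if χ x ∈ τ then ∑ i ∈ S, Z χ k (S.erase i) (sh x i) (τ.erase (χ x)) else 0

lemma Z_of_notMem {d : ℕ} {C : Type} [DecidableEq C] (χ : (Fin d → ℕ) → C) (k : ℕ)
    (S : Finset (Fin d)) (x : Fin d → ℕ) (τ : Finset C) (h : χ x ∉ τ) : Z χ k S x τ = 0 := by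
  cases k with
  | zero =>
    have : τ ≠ {χ x} := fun h' => h (by simp [h'])
    simp [Z, this]
  | succ k => simp [Z, h]

lemma shT_sh {d : ℕ} (x : Fin d → ℕ) (i : Fin d) (T : Finset (Fin d)) (h : i ∉ T) :
    shT (sh x i) T = shT x (insert i T) := by
  funext t
  by_cases ht : t = i
  · subst ht; simp [shT, sh, h]
  · simp [shT, sh, ht]

lemma shT_empty {d : ℕ} (x : Fin d → ℕ) : shT x ∅ = x := by
  funext t; simp [shT]

lemma Z_support {d : ℕ} {C : Type} [DecidableEq C] (χ : (Fin d → ℕ) → C) (k : ℕ) :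
    ∀ (S : Finset (Fin d)) (x : Fin d → ℕ) (τ : Finset C), S.card = k → Z χ k S x τ ≠ 0 →
      τ.card = k + 1 ∧ τ ⊆ S.powerset.image (fun T => χ (shT x T)) := by
  induction k with
  | zero =>
    intro S x τ hS h
    have : τ = {χ x} := by
      by_contra h'
      simp [Z, h'] at h
    subst this
    refine ⟨by simp, ?_⟩
    rw [singleton_subset_iff, mem_image]
    exact ⟨∅, by simp, by simp [shT_empty]⟩
  | succ k ih =>
    intro S x τ hS h
    have hx : χ x ∈ τ := by
      by_contra h'
      simp [Z, h'] at h
    simp only [Z, hx, if_true] at h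
    obtain ⟨i, hi, hne⟩ := exists_ne_zero_of_sum_ne_zero h
    obtain ⟨h1, h2⟩ := ih _ _ _ (by rw [card_erase_of_mem hi, hS]; rfl) hne
    constructor
    · rw [card_erase_of_mem hx] at h1
      have := card_pos.2 ⟨_, hx⟩
      omega
    · intro c hc
      rw [mem_image]
      by_cases hcx : c = χ x
      · exact ⟨∅, by simp, by simp [shT_empty, hcx]⟩
      · have := h2 (mem_erase.2 ⟨hcx, hc⟩)
        rw [mem_image] at this
        obtain ⟨T, hT, rfl⟩ := this
        rw [mem_powerset] at hT
        have hiT : i ∉ T := fun h => by simpa using hT h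
        refine ⟨insert i T, ?_, by rw [shT_sh _ _ _ hiT]⟩
        rw [mem_powerset]
        exact insert_subset hi (hT.trans (erase_subset _ _))

lemma Z_chain {d : ℕ} {C : Type} [DecidableEq C] [Fintype C] (χ : (Fin d → ℕ) → C) (k : ℕ) :
    ∀ (S : Finset (Fin d)) (x : Fin d → ℕ) (τ : Finset C), S.card = k + 1 →
      cob (fun S x => Z χ k S x τ) S x = ∑ c ∈ τᶜ, Z χ (k + 1) S x (insert c τ) := by
  induction k with
  | zero =>
    intro S x τ hS
    obtain ⟨i, rfl⟩ := card_eq_one.1 hS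
    unfold cob
    simp only [sum_singleton, Z]
    by_cases ha : χ x ∈ τ
    · have e : ∀ c ∈ τᶜ, (if χ x ∈ insert c τ then
          (if (insert c τ).erase (χ x) = {χ (sh x i)} then (1 : ZMod 2) else 0) else 0) =
          if τ = {χ x} then (if c = χ (sh x i) then 1 else 0) else 0 := by
        intro c hc
        rw [mem_compl] at hc
        have hca : c ≠ χ x := fun h => hc (h ▸ ha)
        rw [if_pos (mem_insert_of_mem ha), erase_insert_of_ne hca]
        by_cases h : τ = {χ x}
        · simp [h]
        · rw [if_neg h, if_neg]
          intro h'
          apply h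
          have hcm : c ∈ ({χ (sh x i)} : Finset C) := by rw [← h']; simp
          have hce : c = χ (sh x i) := by simpa using hcm
          rw [← hce] at h'
          have hc' : c ∉ τ.erase (χ x) := fun h => hc (mem_of_mem_erase h)
          have h0 : τ.erase (χ x) = ∅ := by
            rw [← erase_insert hc', h']; simp
          rw [← insert_erase ha, h0]; simp
      rw [sum_congr rfl e]
      by_cases h : τ = {χ x}
      · subst h
        by_cases h2 : χ (sh x i) = χ x
        · simp [h2, z2_add_self]
        · have h2' : χ x ≠ χ (sh x i) := fun h => h2 h.symm
          simp [h2, h2']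
      · by_cases h3 : τ = {χ (sh x i)}
        · exfalso
          rw [h3] at ha
          have : χ x = χ (sh x i) := by simpa using ha
          exact h (by rw [h3, this])
        · simp [h, h3]
    · have h0 : τ ≠ {χ x} := fun h => ha (by simp [h])
      rw [sum_eq_single_of_mem (χ x) (by simpa using ha)]
      · simp [h0, erase_insert ha]
      · intro c _ hc
        rw [if_neg]
        simp [ha, hc.symm]
  | succ k ih =>
    intro S x τ hS
    by_cases ha : χ x ∈ τ
    · have e1 : ∀ c ∈ τᶜ, Z χ (k + 1 + 1) S x (insert c τ) =
          ∑ i ∈ S, Z χ (k + 1) (S.erase i) (sh x i) (insert c (τ.erase (χ x))) := by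
        intro c hc
        rw [mem_compl] at hc
        have hca : c ≠ χ x := fun h => hc (h ▸ ha)
        rw [Z, if_pos (mem_insert_of_mem ha), erase_insert_of_ne hca]
      have hcompl : (τ.erase (χ x))ᶜ = insert (χ x) τᶜ := by
        rw [compl_erase]
      have e2 : ∀ i ∈ S, ∑ c ∈ τᶜ, Z χ (k + 1) (S.erase i) (sh x i) (insert c (τ.erase (χ x))) =
          cob (fun S y => Z χ k S y (τ.erase (χ x))) (S.erase i) (sh x i) +
            Z χ (k + 1) (S.erase i) (sh x i) τ := by
        intro i hi
        rw [ih _ _ _ (by rw [card_erase_of_mem hi, hS]; rfl), hcompl,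
          sum_insert (by simpa using ha), insert_erase ha]
        have key : ∀ p q : ZMod 2, p = q + p + q := by decide
        exact key _ _
      have e3 : ∑ i ∈ S, cob (fun S y => Z χ k S y (τ.erase (χ x))) (S.erase i) (sh x i) =
          ∑ i ∈ S, Z χ (k + 1) (S.erase i) x τ := by
        unfold cob
        simp only [sum_add_distrib]
        rw [sum_symm_zero S (fun i j => Z χ k ((S.erase i).erase j) (sh (sh x i) j)
          (τ.erase (χ x))) (by intro i j; rw [erase_right_comm, sh_comm]), add_zero,
          sum_swap_erase]
        refine sum_congr rfl fun i hi => ?_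
        rw [Z, if_pos ha]
        refine sum_congr rfl fun j hj => ?_
        rw [erase_right_comm]
      rw [sum_congr rfl e1, sum_comm, sum_congr rfl e2, sum_add_distrib, e3]
      unfold cob
      rw [sum_add_distrib]
    · rw [sum_eq_single_of_mem (χ x) (by simpa using ha)]
      · rw [Z, if_pos (mem_insert_self _ _), erase_insert ha]
        unfold cob
        refine sum_congr rfl fun i hi => ?_
        beta_reduce
        rw [Z_of_notMem χ _ _ x τ ha, zero_add]
      · intro c _ hc
        refine Z_of_notMem _ _ _ _ _ ?_
        simp [ha, hc.symm]

/-- the local total mass at color `v` -/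
def tot {d : ℕ} {C : Type} [DecidableEq C] [Fintype C] (n k : ℕ) (v : C)
    (u : Finset C → Coch d) : ℕ :=
  ∑ σ ∈ (powersetCard (k + 1) univ).filter (fun σ => v ∈ σ), mass n k (u σ)

/-- initial bound -/
lemma tot_Z_le {d n s k : ℕ} {C : Type} [DecidableEq C] [Fintype C] (χ : (Fin d → ℕ) → C)
    (hcl : ∀ x, χ (fun i => min (x i) n) = χ x)
    (hs : ∀ c, ((box d n).filter (fun x => χ x = c)).card ≤ s) (v : C) :
    tot n k v (fun σ S x => Z χ k S x σ) ≤ (2 ^ d * 2 ^ d * 2 ^ d * 2 ^ (2 ^ d)) * s := by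
  classical
  have h1 : ∀ T : Finset (Fin d),
      ((box d n).filter (fun x => χ (shT x T) = v)).card ≤ 2 ^ d * s := by
    intro T
    refine (card_le_mul_card_image_of_maps_to (f := fun x => fun i => min (shT x T i) n)
      (t := (box d n).filter (fun x => χ x = v)) ?_ (2 ^ d) ?_).trans
        (Nat.mul_le_mul_left _ (hs v))
    · intro x hx
      rw [mem_filter] at hx ⊢
      exact ⟨mem_box.2 fun i => by simp, by rw [hcl]; exact hx.2⟩
    · intro p _
      have hsub : (((box d n).filter (fun x => χ (shT x T) = v)).filter
          (fun x => (fun i => min (shT x T i) n) = p)) ⊆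
          (univ : Finset (Finset (Fin d))).image
            (fun T' => fun i => p i - if i ∈ T' then 1 else 0) := by
        intro x hx
        simp only [mem_filter, mem_image, mem_univ, true_and] at hx ⊢
        obtain ⟨⟨hb, _⟩, rfl⟩ := hx
        rw [mem_box] at hb
        refine ⟨univ.filter (fun i => min (shT x T i) n ≠ x i), ?_⟩
        funext i
        have := hb i
        have hmem : (i ∈ univ.filter (fun i => min (shT x T i) n ≠ x i)) ↔
            min (shT x T i) n ≠ x i := by simp
        have hT : shT x T i = x i ∨ shT x T i = x i + 1 := by
          unfold shT; split_ifs <;> simp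
        beta_reduce
        split_ifs with h
        · rw [hmem] at h; omega
        · rw [hmem, not_not] at h; omega
      refine (card_le_card hsub).trans (card_image_le.trans ?_)
      simp
  have h2 : ∀ S : Finset (Fin d), S.card = k → ∀ x,
      ∑ σ ∈ (powersetCard (k + 1) (univ : Finset C)).filter (fun σ => v ∈ σ), (Z χ k S x σ).val ≤
        2 ^ (2 ^ d) * ∑ T : Finset (Fin d), if χ (shT x T) = v then 1 else 0 := by
    intro S hS x
    by_cases hex : ∃ T : Finset (Fin d), χ (shT x T) = v
    · obtain ⟨T, hT⟩ := hex
      have hone : 1 ≤ ∑ T : Finset (Fin d), if χ (shT x T) = v then 1 else 0 := by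
        have := single_le_sum (f := fun T : Finset (Fin d) => if χ (shT x T) = v then 1 else 0)
          (fun _ _ => Nat.zero_le _) (mem_univ T)
        simpa [hT] using this
      refine le_trans ?_ (Nat.le_mul_of_pos_right _ hone)
      rw [← sum_filter_ne_zero]
      refine (sum_le_card_nsmul _ _ 1 ?_).trans ?_
      · intro σ _
        have := ZMod.val_lt (Z χ k S x σ)
        omega
      · rw [smul_eq_mul, mul_one]
        refine (card_le_card (t := (S.powerset.image (fun T => χ (shT x T))).powerset) ?_).trans ?_
        · intro σ hσ
          rw [mem_filter] at hσ
          rw [mem_powerset]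
          refine (Z_support χ k S x σ hS ?_).2
          intro h; apply hσ.2; rw [h]; rfl
        · rw [card_powerset]
          refine Nat.pow_le_pow_right (by norm_num) (card_image_le.trans ?_)
          rw [card_powerset]
          refine Nat.pow_le_pow_right (by norm_num) ?_
          simpa using card_le_univ S
    · refine le_trans (le_of_eq ?_) (Nat.zero_le _)
      refine sum_eq_zero fun σ hσ => ?_
      rw [ZMod.val_eq_zero]
      by_contra hne
      have := (Z_support χ k S x σ hS hne).2 (mem_filter.1 hσ).2
      rw [mem_image] at this
      obtain ⟨T, _, hT⟩ := this
      exact hex ⟨T, hT⟩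
  unfold tot mass
  rw [sum_comm]
  have h3 : ∀ S ∈ powersetCard k (univ : Finset (Fin d)),
      ∑ σ ∈ (powersetCard (k + 1) (univ : Finset C)).filter (fun σ => v ∈ σ),
        ∑ x ∈ box d n, (Z χ k S x σ).val ≤ 2 ^ (2 ^ d) * (2 ^ d * (2 ^ d * s)) := by
    intro S hS
    rw [sum_comm]
    refine (sum_le_sum fun x _ => h2 S (mem_powersetCard_univ.1 hS) x).trans ?_
    rw [← mul_sum, sum_comm]
    refine Nat.mul_le_mul_left _ ?_
    refine (sum_le_card_nsmul _ _ (2 ^ d * s) ?_).trans (by simp)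
    intro T _
    rw [← card_filter]
    exact h1 T
  refine (sum_le_card_nsmul _ _ _ h3).trans ?_
  have hc : (powersetCard k (univ : Finset (Fin d))).card ≤ 2 ^ d := by
    refine (card_le_univ _).trans (by simp)
  rw [smul_eq_mul]
  refine (Nat.mul_le_mul_right _ hc).trans (le_of_eq (by ring))

lemma double_count {k : ℕ} {C : Type} [DecidableEq C] [Fintype C] (v : C) (g : Finset C → ℕ) :
    ∑ τ ∈ (powersetCard k (univ : Finset C)).filter (fun σ => v ∈ σ), ∑ c ∈ τᶜ, g (insert c τ) ≤
      (k + 1) * ∑ σ ∈ (powersetCard (k + 1) (univ : Finset C)).filter (fun σ => v ∈ σ), g σ := by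
  have : (k + 1) * ∑ σ ∈ (powersetCard (k + 1) (univ : Finset C)).filter (fun σ => v ∈ σ), g σ =
      ∑ σ ∈ (powersetCard (k + 1) (univ : Finset C)).filter (fun σ => v ∈ σ), ∑ c ∈ σ, g σ := by
    rw [mul_sum]
    refine sum_congr rfl fun σ hσ => ?_
    rw [mem_filter, mem_powersetCard_univ] at hσ
    rw [sum_const, hσ.1, smul_eq_mul]
  rw [this, sum_sigma', sum_sigma']
  let φ : (Σ _ : Finset C, C) → (Σ _ : Finset C, C) := fun p => ⟨insert p.2 p.1, p.2⟩
  rw [← sum_image (g := φ) (f := fun p => g p.1)]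
  · refine sum_le_sum_of_subset ?_
    intro p hp
    rw [mem_image] at hp
    obtain ⟨⟨τ, c⟩, h, rfl⟩ := hp
    simp only [mem_sigma, mem_filter, mem_powersetCard_univ, mem_compl, φ] at h ⊢
    refine ⟨⟨?_, mem_insert_of_mem h.1.2⟩, mem_insert_self _ _⟩
    rw [card_insert_of_notMem h.2, h.1.1]
  · rintro ⟨τ, c⟩ h ⟨τ', c'⟩ h' he
    simp only [coe_sigma, Set.mem_sigma_iff, mem_coe, mem_compl] at h h'
    simp only [φ, Sigma.mk.injEq, heq_eq_eq] at he
    obtain ⟨h1, rfl⟩ := he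
    rw [← erase_insert h.2, h1, erase_insert h'.2]

/-- the corrected cochains -/
def corr {d : ℕ} {C : Type} [DecidableEq C] [Fintype C] (χ : (Fin d → ℕ) → C) (k : ℕ)
    (W : Finset C → Coch d) (σ : Finset C) : Coch d :=
  fun S x => Z χ k S x σ + ∑ c ∈ σᶜ, W (insert c σ) S x

/-- the constants -/
def Kc (d : ℕ) : ℕ → ℕ
  | 0 => 2 ^ d * 2 ^ d * 2 ^ d * 2 ^ (2 ^ d)
  | j + 1 => 2 ^ d * 2 ^ d * 2 ^ d * 2 ^ (2 ^ d) + (d + 1) * (d * 2 * Kc d j)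

lemma tower {d n s m : ℕ} (hmd : m ≤ d) {C : Type} [DecidableEq C] [Fintype C]
    (χ : (Fin d → ℕ) → C)
    (hcl : ∀ x, χ (fun i => min (x i) n) = χ x)
    (hs : ∀ c, ((box d n).filter (fun x => χ x = c)).card ≤ s)
    (hcol : ∀ S : Finset (Fin d), S.card = m + 1 → ∀ x,
      (S.powerset.image (fun T => χ (shT x T))).card ≤ m + 1) (j : ℕ) :
    ∀ k, k + j = m → ∃ W : Finset C → Coch d,
      (∀ σ, σ.card = k + 1 → IsCoc k (corr χ k W σ)) ∧
      ∀ v, tot n k v (corr χ k W) ≤ Kc d j * s * (n + 1) ^ j := by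
  induction j with
  | zero =>
    rintro k rfl
    refine ⟨fun _ _ _ => 0, ?_, ?_⟩
    · intro σ hσ S hS x
      have : corr χ k (fun _ _ _ => 0) σ = fun S x => Z χ k S x σ := by
        funext S x; simp [corr]
      rw [this, Z_chain χ k S x σ hS]
      refine sum_eq_zero fun c hc => ?_
      by_contra hne
      obtain ⟨h1, h2⟩ := Z_support χ (k + 1) S x _ hS hne
      have := card_le_card h2
      have := hcol S hS x
      omega
    · intro v
      have : corr χ k (fun _ _ _ => 0) = fun σ S x => Z χ k S x σ := by
        funext σ S x; simp [corr]
      rw [this, pow_zero, mul_one]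
      exact tot_Z_le χ hcl hs v
  | succ j ih =>
    intro k hk
    obtain ⟨W, hW1, hW2⟩ := ih (k + 1) (by omega)
    have hex : ∀ σ : Finset C, ∃ w : Coch d, σ.card = k + 2 →
        ((∀ S : Finset (Fin d), S.card = k + 1 → ∀ x, cob w S x = corr χ (k + 1) W σ S x) ∧
        mass n k w ≤ d * (2 * (n + 1) * mass n (k + 1) (corr χ (k + 1) W σ))) := by
      intro σ
      by_cases h : σ.card = k + 2
      · obtain ⟨w, h1, h2⟩ := fill (n := n) univ _ (hW1 σ h) (by
          intro S _ h; exact absurd (subset_univ S) h)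
        refine ⟨w, fun _ => ⟨h1, ?_⟩⟩
        simpa using h2
      · exact ⟨fun _ _ => 0, fun h' => absurd h' h⟩
    choose V hV using hex
    refine ⟨V, ?_, ?_⟩
    · intro τ hτ S hS x
      unfold corr
      rw [cob_add, Z_chain χ k S x τ hS, cob_sum, ← sum_add_distrib]
      have e : ∀ c ∈ τᶜ, Z χ (k + 1) S x (insert c τ) + cob (V (insert c τ)) S x =
          ∑ c' ∈ τᶜ.erase c, W (insert c' (insert c τ)) S x := by
        intro c hc
        rw [mem_compl] at hc
        rw [(hV (insert c τ) (by rw [card_insert_of_notMem hc, hτ])).1 S hS x]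
        unfold corr
        rw [← add_assoc, z2_add_self, zero_add, compl_insert]
      rw [sum_congr rfl e]
      exact sum_symm_zero _ (fun c c' => W (insert c' (insert c τ)) S x)
        (by intro i j; rw [insert_comm])
    · intro v
      have h1 : tot n k v (corr χ k V) ≤ tot n k v (fun σ S x => Z χ k S x σ) +
          (k + 1 + 1) * ∑ σ ∈ (powersetCard (k + 1 + 1) (univ : Finset C)).filter
            (fun σ => v ∈ σ), mass n k (V σ) := by
        refine le_trans ?_ (Nat.add_le_add_left (double_count v (fun σ => mass n k (V σ))) _)
        unfold tot
        rw [← sum_add_distrib]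
        refine sum_le_sum fun σ _ => ?_
        refine (mass_add_le _ _ _ _).trans (Nat.add_le_add_left ?_ _)
        exact mass_sum_le n k _ (fun c => V (insert c σ))
      have h2 : ∑ σ ∈ (powersetCard (k + 1 + 1) (univ : Finset C)).filter
            (fun σ => v ∈ σ), mass n k (V σ) ≤
            d * (2 * (n + 1) * tot n (k + 1) v (corr χ (k + 1) W)) := by
        unfold tot
        rw [mul_sum, mul_sum]
        refine sum_le_sum fun σ hσ => ?_
        rw [mem_filter, mem_powersetCard_univ] at hσ
        exact (hV σ hσ.1).2
      have h3 := tot_Z_le (k := k) χ hcl hs v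
      have h4 := hW2 v
      have h5 : 1 ≤ (n + 1) ^ (j + 1) := Nat.one_le_pow _ _ (by omega)
      have h6 : k + 1 + 1 ≤ d + 1 := by omega
      calc tot n k v (corr χ k V) ≤ _ := h1
        _ ≤ (2 ^ d * 2 ^ d * 2 ^ d * 2 ^ (2 ^ d)) * s * (n + 1) ^ (j + 1) +
            (d + 1) * (d * (2 * (n + 1) * (Kc d j * s * (n + 1) ^ j))) := by
          refine add_le_add (h3.trans (Nat.le_mul_of_pos_right _ h5)) ?_
          refine Nat.mul_le_mul h6 (h2.trans ?_)
          gcongr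
        _ = Kc d (j + 1) * s * (n + 1) ^ (j + 1) := by
          rw [Kc]; ring

lemma const_of_coc {d : ℕ} (u : Coch d) (h : IsCoc 0 u) :
    ∀ x, u ∅ x = u ∅ 0 := by
  have hstep : ∀ x i, u ∅ (sh x i) = u ∅ x := by
    intro x i
    have := h {i} (by simp) x
    simp only [cob, sum_singleton, erase_singleton] at this
    have key : ∀ p q : ZMod 2, p + q = 0 → q = p := by decide
    exact key _ _ this
  have : ∀ N, ∀ x : Fin d → ℕ, ∑ i, x i = N → u ∅ x = u ∅ 0 := by
    intro N
    induction N with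
    | zero =>
      intro x hx
      have : x = 0 := by
        funext i
        exact (sum_eq_zero_iff.1 hx) i (mem_univ i)
      rw [this]
    | succ N ih =>
      intro x hx
      obtain ⟨i, _, hi⟩ := exists_ne_zero_of_sum_ne_zero (by rw [hx]; omega : ∑ i, x i ≠ 0)
      have hxe : x = sh (Function.update x i (x i - 1)) i := by
        rw [sh_update_same, Nat.sub_add_cancel (by omega), Function.update_eq_self]
      have hsum : ∑ t, Function.update x i (x i - 1) t = N := by
        rw [sum_update_of_mem (mem_univ i)]
        have := add_sum_erase univ x (mem_univ i)
        rw [sdiff_singleton_eq_erase]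
        omega
      rw [hxe, hstep]
      exact ih _ hsum
  intro x
  exact this _ x rfl

theorem core {d n s m : ℕ} (hmd : m ≤ d) {C : Type} [DecidableEq C] [Fintype C]
    (χ : (Fin d → ℕ) → C)
    (hcl : ∀ x, χ (fun i => min (x i) n) = χ x)
    (hs : ∀ c, ((box d n).filter (fun x => χ x = c)).card ≤ s)
    (hcol : ∀ S : Finset (Fin d), S.card = m + 1 → ∀ x,
      (S.powerset.image (fun T => χ (shT x T))).card ≤ m + 1) :
    (n + 1) ^ d ≤ Kc d m * s * (n + 1) ^ m := by
  obtain ⟨W, h1, h2⟩ := tower hmd χ hcl hs hcol m 0 (by simp)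
  have hsum : ∑ v : C, corr χ 0 W {v} ∅ 0 = 1 := by
    unfold corr
    rw [sum_add_distrib]
    have e1 : ∑ v : C, Z χ 0 ∅ 0 {v} = 1 := by simp [Z]
    have e2 : ∑ v : C, ∑ c ∈ ({v} : Finset C)ᶜ, W (insert c {v}) ∅ 0 = 0 := by
      have := sum_symm_zero (univ : Finset C) (fun v c => W (insert c {v}) ∅ 0)
        (by intro i j; rw [pair_comm])
      rw [← this]
      refine sum_congr rfl fun v _ => ?_
      congr 1
      ext; simp
    rw [e1, e2, add_zero]
  obtain ⟨v, _, hv⟩ := exists_ne_zero_of_sum_ne_zero (by rw [hsum]; decide :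
    ∑ v : C, corr χ 0 W {v} ∅ 0 ≠ 0)
  have hc := const_of_coc _ (h1 {v} (by simp))
  refine le_trans ?_ (h2 v)
  have hle : mass n 0 (corr χ 0 W {v}) ≤ tot n 0 v (corr χ 0 W) := by
    unfold tot
    exact single_le_sum (f := fun σ => mass n 0 (corr χ 0 W σ)) (fun _ _ => Nat.zero_le _)
      (by simp)
  refine le_trans ?_ hle
  unfold mass
  rw [powersetCard_zero, sum_singleton, ← card_box d n, card_eq_sum_ones]
  refine sum_le_sum fun x _ => ?_
  rw [hc x]
  have : (corr χ 0 W {v} ∅ 0).val ≠ 0 := by rwa [Ne, ZMod.val_eq_zero]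
  omega

end CubeCol

namespace CubeCol
open Finset

/-- embedding of the finite grid in the integer lattice -/
def toZ {d n : ℕ} (p : Fin d → Fin (n + 1)) : Fin d → ℤ := fun i => ((p i : ℕ) : ℤ)

/-- adjacency of grid points -/
def adj (d m n : ℕ) (a b : Fin d → ℤ) : Prop :=
  ∃ (S : Finset (Fin d)) (x : Fin d → ℤ),
    S.card = m + 1 ∧ (∀ i, 0 ≤ x i ∧ x i ≤ n) ∧ (∀ i ∈ S, x i ≤ (n : ℤ) - 1) ∧
    ∃ ε₁ ε₂ : Fin d → Bool,
      a = (fun i => x i + if i ∈ S ∧ ε₁ i then 1 else 0) ∧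
      b = (fun i => x i + if i ∈ S ∧ ε₂ i then 1 else 0)

lemma adj_symm {d m n : ℕ} {a b : Fin d → ℤ} (h : adj d m n a b) : adj d m n b a := by
  obtain ⟨S, x, h1, h2, h3, e1, e2, h4, h5⟩ := h
  exact ⟨S, x, h1, h2, h3, e2, e1, h5, h4⟩

/-- monochromatic adjacency on the finite grid -/
def rel {d n : ℕ} (m : ℕ) {Colors : Type} (χ : (Fin d → ℤ) → Colors)
    (p q : Fin d → Fin (n + 1)) : Prop :=
  χ (toZ p) = χ (toZ q) ∧ adj d m n (toZ p) (toZ q)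

/-- clamping to the grid -/
def clampF {d : ℕ} (n : ℕ) (x : Fin d → ℕ) : Fin d → Fin (n + 1) :=
  fun i => ⟨min (x i) n, by omega⟩

lemma eqvGen_path {d n m : ℕ} {Colors : Type} (χ : (Fin d → ℤ) → Colors)
    (c : Quot (rel (n := n) m χ)) (M : Set (Fin d → ℤ))
    (hM : M = {v | ∃ p : Fin d → Fin (n + 1), toZ p = v ∧ Quot.mk (rel m χ) p = c})
    (p q : Fin d → Fin (n + 1)) (h : Relation.EqvGen (rel m χ) p q) :
    Quot.mk (rel m χ) p = c →
    Relation.ReflTransGen (fun a b => a ∈ M ∧ b ∈ M ∧ adj d m n a b) (toZ p) (toZ q) := by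
  subst hM
  induction h with
  | rel p q h =>
    intro hp
    refine Relation.ReflTransGen.single ⟨⟨p, rfl, hp⟩, ⟨q, rfl, ?_⟩, h.2⟩
    rw [← hp]; exact (Quot.sound h).symm
  | refl p => intro _; exact Relation.ReflTransGen.refl
  | symm p q h ih =>
    intro hq
    have := ih ((Quot.eqvGen_sound h).trans hq)
    clear ih
    generalize toZ p = P, toZ q = Q at this ⊢
    induction this with
    | refl => exact Relation.ReflTransGen.refl
    | tail _ hbc ih' => exact Relation.ReflTransGen.head ⟨hbc.2.1, hbc.1, adj_symm hbc.2.2⟩ ih'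
  | trans p q r h1 h2 ih1 ih2 =>
    intro hp
    exact (ih1 hp).trans (ih2 ((Quot.eqvGen_sound h1).symm.trans hp))

lemma few_colors {d n m : ℕ} (hn : 1 ≤ n) {Colors : Type} (χ : (Fin d → ℤ) → Colors)
    [DecidableEq (Quot (rel (d := d) (n := n) m χ))]
    (h : ∀ (S : Finset (Fin d)) (x : Fin d → ℤ),
            S.card = m + 1 →
            (∀ i, 0 ≤ x i ∧ x i ≤ n) →
            (∀ i ∈ S, x i ≤ (n : ℤ) - 1) →
            {c : Colors | ∃ ε : Fin d → Bool,
                χ (fun i => x i + if i ∈ S ∧ ε i then 1 else 0) = c}.ncard ≤ m + 1)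
    (S : Finset (Fin d)) (hS : S.card = m + 1) (x : Fin d → ℕ) :
    (S.powerset.image (fun T => Quot.mk (rel (n := n) m χ) (clampF n (shT x T)))).card
      ≤ m + 1 := by
  classical
  let x' : Fin d → ℤ := fun i => if i ∈ S then ((min (x i) (n - 1) : ℕ) : ℤ) else
    ((min (x i) n : ℕ) : ℤ)
  have hx1 : ∀ i, 0 ≤ x' i ∧ x' i ≤ n := by
    intro i; simp only [x']; split_ifs <;> omega
  have hx2 : ∀ i ∈ S, x' i ≤ (n : ℤ) - 1 := by
    intro i hi; simp only [x', hi, if_true]; omega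
  have hpt : ∀ T ∈ S.powerset, ∃ ε : Fin d → Bool,
      toZ (clampF n (shT x T)) = fun i => x' i + if i ∈ S ∧ ε i then 1 else 0 := by
    intro T hT
    rw [mem_powerset] at hT
    refine ⟨fun i => decide (toZ (clampF n (shT x T)) i ≠ x' i), ?_⟩
    funext i
    by_cases hi : i ∈ S
    · have hsh : shT x T i = x i ∨ shT x T i = x i + 1 := by
        unfold shT; split_ifs <;> simp
      have e : x' i = ((min (x i) (n - 1) : ℕ) : ℤ) := by simp [x', hi]
      have e2 : toZ (clampF n (shT x T)) i = ((min (shT x T i) n : ℕ) : ℤ) := rfl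
      rw [e2, e]
      simp only [hi, true_and, decide_eq_true_eq]
      split_ifs with h <;> omega
    · have hiT : i ∉ T := fun h => hi (hT h)
      simp [toZ, clampF, shT, x', hi, hiT]
  let col : Quot (rel (n := n) m χ) → Colors :=
    Quot.lift (fun p => χ (toZ p)) (fun p q h => h.1)
  refine le_trans ?_ (h S x' hS hx1 hx2)
  have hfin : {c : Colors | ∃ ε : Fin d → Bool,
      χ (fun i => x' i + if i ∈ S ∧ ε i then 1 else 0) = c}.Finite :=
    Set.finite_range (fun ε : Fin d → Bool => χ (fun i => x' i + if i ∈ S ∧ ε i then 1 else 0))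
  rw [← Set.ncard_coe_finset]
  refine Set.ncard_le_ncard_of_injOn col ?_ ?_ hfin
  · intro q hq
    rw [mem_coe, mem_image] at hq
    obtain ⟨T, hT, rfl⟩ := hq
    obtain ⟨ε, hε⟩ := hpt T hT
    exact ⟨ε, by rw [← hε]⟩
  · intro q hq q' hq' he
    rw [mem_coe, mem_image] at hq hq'
    obtain ⟨T, hT, rfl⟩ := hq
    obtain ⟨T', hT', rfl⟩ := hq'
    obtain ⟨ε, hε⟩ := hpt T hT
    obtain ⟨ε', hε'⟩ := hpt T' hT'
    exact Quot.sound ⟨he, S, x', hS, hx1, hx2, ε, ε', hε, hε'⟩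

lemma Kc_pos (d j : ℕ) : 0 < Kc d j := by
  cases j <;> simp only [Kc] <;> positivity

end CubeCol

/-- **Size of components of a cube coloring** (Matdinov, Theorem 1 with Remark 2,
connected monochromatic component form). For all integers `d ≥ 1` and `0 ≤ m ≤ d−1`
there is a constant `f(d,m) > 0` such that: for every `n ≥ 1` and every coloring `χ` of
the lattice points of `{0,…,n}^d` (encoded as integer points `x : Fin d → ℤ` with
`0 ≤ x i ≤ n`) in which every cubical `(m+1)`-dimensional face of the grid carries at
most `m+1` distinct colors, there is a monochromatic set `M` of grid points, connected
in the adjacency graph (two vertices being adjacent when they lie in a common cubical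
`(m+1)`-face of the grid), with `|M| ≥ f(d,m) · n^(d−m)`. -/
theorem cube_coloring_large_connected_monochromatic_component
    (d m : ℕ) (hd : 1 ≤ d) (hm : m ≤ d - 1) :
    ∃ f : ℝ, 0 < f ∧
      ∀ (n : ℕ), 1 ≤ n → ∀ (Colors : Type) (χ : (Fin d → ℤ) → Colors),
        (∀ (S : Finset (Fin d)) (x : Fin d → ℤ),
            S.card = m + 1 →
            (∀ i, 0 ≤ x i ∧ x i ≤ n) →
            (∀ i ∈ S, x i ≤ (n : ℤ) - 1) →
            {c : Colors | ∃ ε : Fin d → Bool,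
                χ (fun i => x i + if i ∈ S ∧ ε i then 1 else 0) = c}.ncard ≤ m + 1) →
        ∃ M : Set (Fin d → ℤ), ∃ c : Colors,
          -- `M` consists of grid points and is monochromatic of color `c`
          (∀ v ∈ M, (∀ i, 0 ≤ v i ∧ v i ≤ n) ∧ χ v = c) ∧
          -- `M` is connected in the induced adjacency graph: any two of its points are
          -- joined by a path inside `M` whose consecutive points lie in a common
          -- cubical (m+1)-face of the grid
          (∀ u ∈ M, ∀ v ∈ M,
            Relation.ReflTransGen
              (fun a b => a ∈ M ∧ b ∈ M ∧
                ∃ (S : Finset (Fin d)) (x : Fin d → ℤ),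
                  S.card = m + 1 ∧
                  (∀ i, 0 ≤ x i ∧ x i ≤ n) ∧
                  (∀ i ∈ S, x i ≤ (n : ℤ) - 1) ∧
                  ∃ ε₁ ε₂ : Fin d → Bool,
                    a = (fun i => x i + if i ∈ S ∧ ε₁ i then 1 else 0) ∧
                    b = (fun i => x i + if i ∈ S ∧ ε₂ i then 1 else 0))
              u v) ∧
          f * (n : ℝ) ^ (d - m) ≤ (M.ncard : ℝ) := by
  classical
  have hmd : m ≤ d := by omega
  have hK : (0 : ℝ) < CubeCol.Kc d m := by exact_mod_cast CubeCol.Kc_pos d m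
  refine ⟨1 / CubeCol.Kc d m, by positivity, ?_⟩
  intro n hn Colors χ h
  let χ' : (Fin d → ℕ) → Quot (CubeCol.rel (n := n) m χ) :=
    fun x => Quot.mk _ (CubeCol.clampF n x)
  haveI : Fintype (Quot (CubeCol.rel (d := d) (n := n) m χ)) :=
    Fintype.ofSurjective (Quot.mk _) Quot.mk_surjective
  let sz : Quot (CubeCol.rel (d := d) (n := n) m χ) → ℕ :=
    fun c => ((CubeCol.box d n).filter (fun x => χ' x = c)).card
  obtain ⟨c, _, hc⟩ := Finset.exists_max_image Finset.univ sz ⟨χ' 0, Finset.mem_univ _⟩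
  have hcore := CubeCol.core (n := n) (s := sz c) hmd χ' (by
    intro x
    simp only [χ']
    congr 1
    funext i
    simp [CubeCol.clampF]) (fun c' => hc c' (Finset.mem_univ _))
    (fun S hS x => CubeCol.few_colors hn χ h S hS x)
  let M : Set (Fin d → ℤ) :=
    {v | ∃ p : Fin d → Fin (n + 1), CubeCol.toZ p = v ∧ Quot.mk (CubeCol.rel m χ) p = c}
  let col : Quot (CubeCol.rel (d := d) (n := n) m χ) → Colors :=
    Quot.lift (fun p => χ (CubeCol.toZ p)) (fun p q h => h.1)
  refine ⟨M, col c, ?_, ?_, ?_⟩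
  · rintro v ⟨p, rfl, rfl⟩
    refine ⟨fun i => ?_, rfl⟩
    have := (p i).2
    simp only [CubeCol.toZ]
    omega
  · rintro u ⟨p, rfl, hp⟩ v ⟨q, rfl, hq⟩
    exact CubeCol.eqvGen_path χ c M rfl p q (Quot.eqvGen_exact (hp.trans hq.symm)) hp
  · have hfinM : M.Finite := by
      refine (Set.finite_range (CubeCol.toZ (d := d) (n := n))).subset ?_
      rintro v ⟨p, rfl, _⟩
      exact ⟨p, rfl⟩
    have hcard : sz c ≤ M.ncard := by
      simp only [sz]
      rw [← Set.ncard_coe_finset]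
      refine Set.ncard_le_ncard_of_injOn (fun x => CubeCol.toZ (CubeCol.clampF n x)) ?_ ?_ hfinM
      · intro x hx
        rw [Finset.mem_coe, Finset.mem_filter] at hx
        exact ⟨_, rfl, hx.2⟩
      · intro x hx y hy he
        rw [Finset.mem_coe, Finset.mem_filter, CubeCol.mem_box] at hx hy
        funext i
        have h1 := congrFun he i
        simp only [CubeCol.toZ, CubeCol.clampF] at h1
        have := hx.1 i
        have := hy.1 i
        omega
    have hpow : n ^ (d - m) ≤ CubeCol.Kc d m * sz c := by
      have h1 : (n + 1) ^ (d - m) * (n + 1) ^ m ≤ CubeCol.Kc d m * sz c * (n + 1) ^ m := by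
        rw [← pow_add, Nat.sub_add_cancel hmd]
        exact hcore
      have h2 := Nat.le_of_mul_le_mul_right h1 (by positivity)
      exact (Nat.pow_le_pow_left (by omega) _).trans h2
    have hfinal : (n : ℝ) ^ (d - m) ≤ CubeCol.Kc d m * (M.ncard : ℝ) := by
      exact_mod_cast hpow.trans (Nat.mul_le_mul_left _ hcard)
    rw [one_div, inv_mul_le_iff₀ hK]
    exact hfinal
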